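/- arXiv:1101.2264 — 5 statements merged into one kernel-verified Lean document; each statement's English description precedes it below -/
import Mathlib

section
/- (Reciprocal of Desargues' theorem) Let ABC and A₁B₁C₁ be two nondegenerate triangles in a real affine plane with A ≠ A₁, B ≠ B₁, C ≠ C₁. Suppose the lines AB and A₁B₁ meet in a point N, the lines BC and B₁C₁ meet in a point M, the lines CA and C₁A₁ meet in a point P, and that N, M, P are collinear. Assume moreover that no two of the lines AA₁, BB₁, CC₁ are parallel (each pair of them meets in a point). Then the three lines AA₁, BB₁, CC₁ are concurrent, i.e., the triangles ABC and A₁B₁C₁ are homological. -/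
/-- The real affine plane. -/
noncomputable abbrev Pt : Type := EuclideanSpace ℝ (Fin 2)

/-- The line through two points `X`, `Y`: the affine span of `{X, Y}`. -/
noncomputable def line (X Y : Pt) : AffineSubspace ℝ Pt := affineSpan ℝ {X, Y}

/-- Twice the signed area of the triangle `XYZ`. -/
noncomputable def signedArea (X Y Z : Pt) : ℝ :=
  (Y 0 - X 0) * (Z 1 - X 1) - (Y 1 - X 1) * (Z 0 - X 0)

/-- The determinant of the direction vectors of the lines `XX₂` and `YY₂`. -/
noncomputable def directionDet (X X₂ Y Y₂ : Pt) : ℝ :=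
  (X₂ 0 - X 0) * (Y₂ 1 - Y 1) - (X₂ 1 - X 1) * (Y₂ 0 - Y 0)

/-- The determinant of the coefficient vectors of the equations of the lines `XX₂`, `YY₂`, `ZZ₂`. -/
noncomputable def lineDet (X X₂ Y Y₂ Z Z₂ : Pt) : ℝ :=
  directionDet X X₂ Y Y₂ * (Z 0 * Z₂ 1 - Z 1 * Z₂ 0)
    + directionDet Y Y₂ Z Z₂ * (X 0 * X₂ 1 - X 1 * X₂ 0)
    + directionDet Z Z₂ X X₂ * (Y 0 * Y₂ 1 - Y 1 * Y₂ 0)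

theorem pt_ext {X Y : Pt} (h0 : X 0 = Y 0) (h1 : X 1 = Y 1) : X = Y := by
  ext i
  fin_cases i
  · exact h0
  · exact h1

theorem mem_line_of_signedArea_eq_zero {X Y Z : Pt} (hXY : X ≠ Y) (h : signedArea X Y Z = 0) :
    Z ∈ line X Y := by
  rw [line, mem_affineSpan_pair_iff_exists_lineMap_eq]
  unfold signedArea at h
  by_cases h0 : Y 0 - X 0 = 0
  · have h1 : Y 1 - X 1 ≠ 0 := fun h1 =>
      hXY (pt_ext (sub_eq_zero.mp h0).symm (sub_eq_zero.mp h1).symm)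
    refine ⟨(Z 1 - X 1) / (Y 1 - X 1), pt_ext ?_ ?_⟩
    · simp [AffineMap.lineMap_apply]
      field_simp
      linear_combination h
    · simp [AffineMap.lineMap_apply]
      field_simp
      ring
  · refine ⟨(Z 0 - X 0) / (Y 0 - X 0), pt_ext ?_ ?_⟩
    · simp [AffineMap.lineMap_apply]
      field_simp
      ring
    · simp [AffineMap.lineMap_apply]
      field_simp
      linear_combination -h

theorem signedArea_eq_zero_of_mem_line {X Y Z : Pt} (h : Z ∈ line X Y) :
    signedArea X Y Z = 0 := by
  rw [line, mem_affineSpan_pair_iff_exists_lineMap_eq] at h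
  obtain ⟨r, rfl⟩ := h
  simp [signedArea, AffineMap.lineMap_apply]
  ring

theorem signedArea_eq_zero_of_collinear {X Y Z : Pt} (h : Collinear ℝ ({X, Y, Z} : Set Pt)) :
    signedArea X Y Z = 0 := by
  by_cases hXY : X = Y
  · simp [signedArea, hXY]
  · exact signedArea_eq_zero_of_mem_line
      (h.mem_affineSpan_of_mem_of_ne (by simp) (by simp) (by simp) hXY)

theorem signedArea_ne_zero_of_affineIndependent {X Y Z : Pt}
    (h : AffineIndependent ℝ ![X, Y, Z]) : signedArea X Y Z ≠ 0 := by
  intro h0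
  have hXY : X ≠ Y := fun e => by simpa using h.injective.ne (show (0 : Fin 3) ≠ 1 by decide) e
  rw [affineIndependent_iff_not_collinear_set] at h
  have hZ := mem_line_of_signedArea_eq_zero hXY h0
  apply h
  have := (collinear_insert_iff_of_mem_affineSpan hZ).mpr (collinear_pair ℝ X Y)
  convert this using 1
  ext p
  simp only [Set.mem_insert_iff, Set.mem_singleton_iff]
  tauto

/-- Cramer's rule for the intersection point of two lines. -/
theorem directionDet_mul_coord {X X₂ Y Y₂ Z : Pt} (hX : signedArea X X₂ Z = 0)
    (hY : signedArea Y Y₂ Z = 0) :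
    directionDet X X₂ Y Y₂ * Z 0 = (X₂ 0 - X 0) * (Y 0 * Y₂ 1 - Y 1 * Y₂ 0)
        - (Y₂ 0 - Y 0) * (X 0 * X₂ 1 - X 1 * X₂ 0)
      ∧ directionDet X X₂ Y Y₂ * Z 1 = (X₂ 1 - X 1) * (Y 0 * Y₂ 1 - Y 1 * Y₂ 0)
        - (Y₂ 1 - Y 1) * (X 0 * X₂ 1 - X 1 * X₂ 0) := by
  unfold signedArea directionDet at *
  constructor
  · linear_combination (Y₂ 0 - Y 0) * hX - (X₂ 0 - X 0) * hY
  · linear_combination (Y₂ 1 - Y 1) * hX - (X₂ 1 - X 1) * hY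

theorem desargues_identity (A B C A₁ B₁ C₁ N M P : Pt)
    (hN₁ : signedArea A B N = 0) (hN₂ : signedArea A₁ B₁ N = 0)
    (hM₁ : signedArea B C M = 0) (hM₂ : signedArea B₁ C₁ M = 0)
    (hP₁ : signedArea C A P = 0) (hP₂ : signedArea C₁ A₁ P = 0) :
    signedArea A B C * signedArea A₁ B₁ C₁ * lineDet A A₁ B B₁ C C₁
      = directionDet A B A₁ B₁ * directionDet B C B₁ C₁ * directionDet C A C₁ A₁
        * signedArea N M P := by
  obtain ⟨n0, n1⟩ := directionDet_mul_coord hN₁ hN₂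
  obtain ⟨m0, m1⟩ := directionDet_mul_coord hM₁ hM₂
  obtain ⟨p0, p1⟩ := directionDet_mul_coord hP₁ hP₂
  have key : directionDet A B A₁ B₁ * directionDet B C B₁ C₁ * directionDet C A C₁ A₁
        * signedArea N M P =
      directionDet C A C₁ A₁ * ((directionDet A B A₁ B₁ * N 0) * (directionDet B C B₁ C₁ * M 1)
        - (directionDet A B A₁ B₁ * N 1) * (directionDet B C B₁ C₁ * M 0))
      + directionDet A B A₁ B₁ * ((directionDet B C B₁ C₁ * M 0) * (directionDet C A C₁ A₁ * P 1)
        - (directionDet B C B₁ C₁ * M 1) * (directionDet C A C₁ A₁ * P 0))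
      + directionDet B C B₁ C₁ * ((directionDet C A C₁ A₁ * P 0) * (directionDet A B A₁ B₁ * N 1)
        - (directionDet C A C₁ A₁ * P 1) * (directionDet A B A₁ B₁ * N 0)) := by
    unfold signedArea
    ring
  rw [key, n0, n1, m0, m1, p0, p1]
  unfold signedArea lineDet directionDet
  ring

theorem lineDet_eq_directionDet_mul {X X₂ Y Y₂ Z Z₂ O : Pt} (hX : signedArea X X₂ O = 0)
    (hY : signedArea Y Y₂ O = 0) :
    lineDet X X₂ Y Y₂ Z Z₂ = directionDet X X₂ Y Y₂ * signedArea Z Z₂ O := by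
  obtain ⟨h0, h1⟩ := directionDet_mul_coord hX hY
  unfold lineDet
  unfold signedArea directionDet at *
  linear_combination (Z₂ 1 - Z 1) * h0 - (Z₂ 0 - Z 0) * h1

/-- Two parallel lines with a common point have all their points in common. -/
theorem signedArea_eq_zero_of_directionDet_eq_zero {X X₂ Y Y₂ O Q : Pt} (hne : X ≠ X₂)
    (hd : directionDet X X₂ Y Y₂ = 0) (hX : signedArea X X₂ O = 0) (hY : signedArea Y Y₂ O = 0)
    (hQ : signedArea X X₂ Q = 0) : signedArea Y Y₂ Q = 0 := by
  by_contra h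
  apply hne
  unfold signedArea directionDet at *
  apply pt_ext
  · refine (sub_eq_zero.mp ((mul_eq_zero.mp ?_).resolve_right h)).symm
    linear_combination -(Q 0 - O 0) * hd + (X₂ 0 - X 0) * hY + (Y₂ 0 - Y 0) * (hQ - hX)
  · refine (sub_eq_zero.mp ((mul_eq_zero.mp ?_).resolve_right h)).symm
    linear_combination -(Q 1 - O 1) * hd + (X₂ 1 - X 1) * hY + (Y₂ 1 - Y 1) * (hQ - hX)

/-- **Reciprocal of Desargues' theorem.** If the corresponding sides of two nondegenerate
triangles `ABC` and `A₁B₁C₁` meet in three collinear points `N`, `M`, `P`, and each pair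
of the lines `AA₁`, `BB₁`, `CC₁` meets in a point, then the three lines `AA₁`, `BB₁`,
`CC₁` are concurrent, i.e. the triangles are homological. -/
theorem desargues_reciprocal (A B C A₁ B₁ C₁ N M P : Pt)
    (hABC : AffineIndependent ℝ ![A, B, C])
    (hA₁B₁C₁ : AffineIndependent ℝ ![A₁, B₁, C₁])
    (hAA₁ : A ≠ A₁) (hBB₁ : B ≠ B₁) (hCC₁ : C ≠ C₁)
    (hN₁ : N ∈ line A B) (hN₂ : N ∈ line A₁ B₁)
    (hM₁ : M ∈ line B C) (hM₂ : M ∈ line B₁ C₁)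
    (hP₁ : P ∈ line C A) (hP₂ : P ∈ line C₁ A₁)
    (hcol : Collinear ℝ ({N, M, P} : Set Pt))
    (hab : ∃ X, X ∈ line A A₁ ∧ X ∈ line B B₁)
    (hac : ∃ X, X ∈ line A A₁ ∧ X ∈ line C C₁)
    (hbc : ∃ X, X ∈ line B B₁ ∧ X ∈ line C C₁) :
    ∃ O, O ∈ line A A₁ ∧ O ∈ line B B₁ ∧ O ∈ line C C₁ := by
  obtain ⟨X, hXA, hXB⟩ := hab
  obtain ⟨Y, hYA, hYC⟩ := hac
  have hXA' := signedArea_eq_zero_of_mem_line hXA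
  have hXB' := signedArea_eq_zero_of_mem_line hXB
  by_cases hd : directionDet A A₁ B B₁ = 0
  · exact ⟨Y, hYA, mem_line_of_signedArea_eq_zero hBB₁
      (signedArea_eq_zero_of_directionDet_eq_zero hAA₁ hd hXA' hXB'
        (signedArea_eq_zero_of_mem_line hYA)), hYC⟩
  · have h := desargues_identity A B C A₁ B₁ C₁ N M P
      (signedArea_eq_zero_of_mem_line hN₁) (signedArea_eq_zero_of_mem_line hN₂)
      (signedArea_eq_zero_of_mem_line hM₁) (signedArea_eq_zero_of_mem_line hM₂)
      (signedArea_eq_zero_of_mem_line hP₁) (signedArea_eq_zero_of_mem_line hP₂)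
    rw [signedArea_eq_zero_of_collinear hcol, mul_zero,
      lineDet_eq_directionDet_mul hXA' hXB'] at h
    have hABC' := signedArea_ne_zero_of_affineIndependent hABC
    have hA₁B₁C₁' := signedArea_ne_zero_of_affineIndependent hA₁B₁C₁
    exact ⟨X, hXA, hXB, mem_line_of_signedArea_eq_zero hCC₁ (by simp_all)⟩
end

section
/- (Newton–Gauss line) Let ABCD be a convex quadrilateral in the real affine plane such that the lines AB and CD meet in a point E and the lines BC and AD meet in a point F (so that A, B, C, D, E, F form a complete quadrilateral). Then the midpoint O₁ of segment AC, the midpoint O₂ of segment BD, and the midpoint O₃ of segment EF are collinear. -/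
/-- Three points of the plane are collinear as soon as the determinant of the two vectors
joining the first one to the others vanishes. -/
theorem collinear_of_det_eq_zero (P Q R : Pt)
    (h : (Q 0 - P 0) * (R 1 - P 1) = (Q 1 - P 1) * (R 0 - P 0)) :
    Collinear ℝ ({P, Q, R} : Set Pt) := by
  by_cases hPQ : P = Q
  · simpa [hPQ] using collinear_pair ℝ Q R
  suffices ∃ r : ℝ, R 0 = r * (Q 0 - P 0) + P 0 ∧ R 1 = r * (Q 1 - P 1) + P 1 by
    obtain ⟨r, hr₀, hr₁⟩ := this
    refine (collinear_iff_of_mem (p₀ := P) (by simp)).2 ⟨Q - P, ?_⟩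
    rintro X (rfl | rfl | rfl)
    · exact ⟨0, by simp⟩
    · exact ⟨1, by simp⟩
    · refine ⟨r, ?_⟩
      ext i
      fin_cases i
      · simpa using hr₀
      · simpa using hr₁
  by_cases h₀ : Q 0 - P 0 = 0
  · have h₁ : Q 1 - P 1 ≠ 0 := by
      intro h₁
      apply hPQ
      ext i
      fin_cases i
      · exact (sub_eq_zero.1 h₀).symm
      · exact (sub_eq_zero.1 h₁).symm
    refine ⟨(R 1 - P 1) / (Q 1 - P 1), ?_, ?_⟩ <;> field_simp <;> linarith
  · refine ⟨(R 0 - P 0) / (Q 0 - P 0), ?_, ?_⟩ <;> field_simp <;> linarith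

/-- A point of a line, in coordinates. -/
theorem exists_coord_of_mem_line {X Y Z : Pt} (h : Z ∈ line X Y) :
    ∃ t : ℝ, ∀ i, Z i = X i + t * (Y i - X i) := by
  obtain ⟨t, rfl⟩ := mem_affineSpan_pair_iff_exists_lineMap_eq.1 h
  exact ⟨t, fun i => by simp [AffineMap.lineMap_apply]; ring⟩

/-- A point of a line satisfies the determinant equation of the line. -/
theorem det_eq_zero_of_mem_line {X Y Z : Pt} (h : Z ∈ line X Y) :
    (Z 0 - X 0) * (Y 1 - X 1) - (Z 1 - X 1) * (Y 0 - X 0) = 0 := by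
  obtain ⟨t, ht⟩ := exists_coord_of_mem_line h
  rw [ht 0, ht 1]
  ring

/-- **Newton–Gauss line.** Let `ABCD` be a convex quadrilateral (no three of its vertices
collinear) such that the lines `AB` and `CD` meet in `E` and the lines `BC` and `AD`
meet in `F`. Then the midpoints of the three diagonals `AC`, `BD`, `EF` of the complete
quadrilateral are collinear. -/
theorem newton_gauss_line (A B C D E F : Pt)
    (h₁ : ¬ Collinear ℝ ({A, B, C} : Set Pt))
    (h₂ : ¬ Collinear ℝ ({A, B, D} : Set Pt))
    (h₃ : ¬ Collinear ℝ ({A, C, D} : Set Pt))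
    (h₄ : ¬ Collinear ℝ ({B, C, D} : Set Pt))
    (hE₁ : E ∈ line A B) (hE₂ : E ∈ line C D)
    (hF₁ : F ∈ line B C) (hF₂ : F ∈ line A D) :
    Collinear ℝ ({midpoint ℝ A C, midpoint ℝ B D, midpoint ℝ E F} : Set Pt) := by
  apply collinear_of_det_eq_zero
  have hmid (X Y : Pt) (i : Fin 2) : midpoint ℝ X Y i = (X i + Y i) / 2 := by
    simp [midpoint_eq_smul_add]
    ring
  have hCD := det_eq_zero_of_mem_line hE₂
  have hBC := det_eq_zero_of_mem_line hF₁
  obtain ⟨a, ha⟩ := exists_coord_of_mem_line hE₁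
  obtain ⟨d, hd⟩ := exists_coord_of_mem_line hF₂
  simp only [hmid]
  rw [ha 0, ha 1] at hCD ⊢
  rw [hd 0, hd 1] at hBC ⊢
  linarith
end

section
/- (Intermediate claim in the proof of Problem 2, part i) Let ABCD be a convex quadrilateral (no three vertices collinear) in the real affine plane with E = AB ∩ CD, F = BC ∩ AD, P = BD ∩ EF, R = AC ∩ EF, O = AC ∩ BD all existing, and let G, H, I be the midpoints of segments AB, BF, AF. Let O₁, O₂, O₃ be the midpoints of the diagonals AC, BD, EF respectively. Then the corresponding sides of the triangles GHI and ORP meet on the Newton–Gauss line; specifically: O₁ lies on line GI and on line OR; O₂ lies on line GH and on line OP; O₃ lies on line HI and on line PR. -/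
/-- The homothety centred at `X` with ratio `1 / 2` maps lines to lines. -/
lemma midpoint_mem_line_midpoint (X : Pt) {Y Z T : Pt} (h : T ∈ line Y Z) :
    midpoint ℝ X T ∈ line (midpoint ℝ X Y) (midpoint ℝ X Z) := by
  obtain ⟨r, rfl⟩ := mem_affineSpan_pair_iff_exists_lineMap_eq.1 h
  refine mem_affineSpan_pair_iff_exists_lineMap_eq.2 ⟨r, ?_⟩
  simp only [AffineMap.lineMap_apply_module, midpoint_eq_smul_add]
  module

lemma line_comm (X Y : Pt) : line X Y = line Y X := by
  rw [line, line, Set.pair_comm]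

lemma left_mem_line (X Y : Pt) : X ∈ line X Y := left_mem_affineSpan_pair ℝ X Y

lemma right_mem_line (X Y : Pt) : Y ∈ line X Y := right_mem_affineSpan_pair ℝ X Y

lemma midpoint_mem_line (X Y : Pt) : midpoint ℝ X Y ∈ line X Y :=
  AffineMap.lineMap_mem_affineSpan_pair _ _ _

/-- Two distinct points of a line span it. -/
lemma mem_line_of_ne {X Y U V T : Pt} (hU : U ∈ line X Y) (hV : V ∈ line X Y)
    (hT : T ∈ line X Y) (hne : U ≠ V) : T ∈ line U V :=
  (collinear_triple_of_mem_affineSpan_pair hU hV hT).mem_affineSpan_of_mem_of_ne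
    (by simp) (by simp) (by simp) hne

/-- **Intermediate claim in the proof of Problem 2, part i.** In the complete
quadrilateral `ABCDEF` with diagonal triangle `POR`, let `G`, `H`, `I` be the midpoints
of `AB`, `BF`, `AF`, and let `O₁`, `O₂`, `O₃` be the midpoints of the diagonals `AC`,
`BD`, `EF` (all named points being pairwise distinct). Then the corresponding sides of
the triangles `GHI` and `ORP` meet on the Newton–Gauss line: `O₁ ∈ GI ∩ OR`,
`O₂ ∈ GH ∩ OP`, `O₃ ∈ HI ∩ PR`. -/
theorem problem2_i_intermediate (A B C D E F P R O G H I O₁ O₂ O₃ : Pt)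
    (h₁ : ¬ Collinear ℝ ({A, B, C} : Set Pt))
    (h₂ : ¬ Collinear ℝ ({A, B, D} : Set Pt))
    (h₃ : ¬ Collinear ℝ ({A, C, D} : Set Pt))
    (h₄ : ¬ Collinear ℝ ({B, C, D} : Set Pt))
    (hE₁ : E ∈ line A B) (hE₂ : E ∈ line C D)
    (hF₁ : F ∈ line B C) (hF₂ : F ∈ line A D)
    (hP₁ : P ∈ line B D) (hP₂ : P ∈ line E F)
    (hR₁ : R ∈ line A C) (hR₂ : R ∈ line E F)
    (hO₁ : O ∈ line A C) (hO₂ : O ∈ line B D)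
    (hG : G = midpoint ℝ A B) (hH : H = midpoint ℝ B F) (hI : I = midpoint ℝ A F)
    (hO₁ : O₁ = midpoint ℝ A C) (hO₂ : O₂ = midpoint ℝ B D) (hO₃ : O₃ = midpoint ℝ E F)
    (hdist : List.Pairwise (· ≠ ·) [A, B, C, D, E, F, P, R, O, G, H, I, O₁, O₂, O₃]) :
    (O₁ ∈ line G I ∧ O₁ ∈ line O R) ∧
    (O₂ ∈ line G H ∧ O₂ ∈ line O P) ∧
    (O₃ ∈ line H I ∧ O₃ ∈ line P R) := by
  rw [List.pairwise_iff_getElem] at hdist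
  have hBF : B ≠ F := hdist 1 5 (by simp) (by simp) (by simp)
  have hAF : A ≠ F := hdist 0 5 (by simp) (by simp) (by simp)
  have hOR : O ≠ R := (hdist 7 8 (by simp) (by simp) (by simp)).symm
  have hOP : O ≠ P := (hdist 6 8 (by simp) (by simp) (by simp)).symm
  have hPR : P ≠ R := hdist 6 7 (by simp) (by simp) (by simp)
  have hC : C ∈ line B F := mem_line_of_ne (left_mem_line B C) hF₁ (right_mem_line B C) hBF
  have hD : D ∈ line A F := mem_line_of_ne (left_mem_line A D) hF₂ (right_mem_line A D) hAF
  subst hG hH hI hO₁ hO₂ hO₃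
  refine ⟨⟨midpoint_mem_line_midpoint A hC, mem_line_of_ne hO₁ hR₁ (midpoint_mem_line A C) hOR⟩,
    ⟨?_, mem_line_of_ne hO₂ hP₁ (midpoint_mem_line B D) hOP⟩,
    ⟨?_, mem_line_of_ne hP₂ hR₂ (midpoint_mem_line E F) hPR⟩⟩
  · rw [midpoint_comm A B]
    exact midpoint_mem_line_midpoint B hD
  · rw [midpoint_comm B F, midpoint_comm A F, midpoint_comm E F]
    exact midpoint_mem_line_midpoint F (line_comm A B ▸ hE₁)
end

section
/- (Lemma used in Problem 2, part iv) Let T₁ = A₁B₁C₁, T₂ = A₂B₂C₂, T₃ = A₃B₃C₃ be three nondegenerate triangles in the real affine plane which are pairwise homological: the lines A₁A₂, B₁B₂, C₁C₂ are concurrent at a point S₁₂; the lines A₁A₃, B₁B₃, C₁C₃ are concurrent at a point S₁₃; and the lines A₂A₃, B₂B₃, C₂C₃ are concurrent at a point S₂₃. Suppose moreover that the three pairs have the same homology axis: there is a single line ℓ such that for each pair (i, j), the intersection points of corresponding sides (AᵢBᵢ with AⱼBⱼ, BᵢCᵢ with BⱼCⱼ, CᵢAᵢ with CⱼAⱼ)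 all lie on ℓ. Then the three homology centers S₁₂, S₁₃, S₂₃ are collinear. -/
lemma mem_line {P U V : Pt} : P ∈ line U V ↔ ∃ t : ℝ, P = U + t • (V - U) := by
  rw [line, mem_affineSpan_pair_iff_exists_lineMap_eq]
  simp only [AffineMap.lineMap_apply, vsub_eq_sub, vadd_eq_add, add_comm, eq_comm]

lemma left_mem_line_s12 (U V : Pt) : U ∈ line U V := left_mem_affineSpan_pair ℝ U V

lemma right_mem_line_s12 (U V : Pt) : V ∈ line U V := right_mem_affineSpan_pair ℝ U V

lemma line_comm_s12 (U V : Pt) : line U V = line V U := by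
  rw [line, line, Set.pair_comm]

lemma line_le {U V : Pt} {L : AffineSubspace ℝ Pt} (hU : U ∈ L) (hV : V ∈ L) : line U V ≤ L :=
  affineSpan_pair_le_of_mem_of_mem hU hV

lemma line_eq_of_mem {U V P Q : Pt} (hPQ : P ≠ Q) (hP : P ∈ line U V) (hQ : Q ∈ line U V) :
    line P Q = line U V := by
  apply le_antisymm (line_le hP hQ)
  obtain ⟨p, rfl⟩ := mem_line.1 hP
  obtain ⟨q, rfl⟩ := mem_line.1 hQ
  have hpq : q - p ≠ 0 := fun h => hPQ (by rw [sub_eq_zero.1 h])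
  have aux : ∀ s : ℝ, U + s • (V - U) ∈ line (U + p • (V - U)) (U + q • (V - U)) := fun s =>
    mem_line.2 ⟨(s - p) / (q - p), by
      have h : (s - p) / (q - p) * (q - p) = s - p := div_mul_cancel₀ _ hpq
      rw [add_sub_add_left_eq_sub, ← sub_smul, smul_smul, h]
      module⟩
  apply line_le
  · simpa using aux 0
  · simpa using aux 1

lemma mem_line_of_collinear {N P Q U V : Pt} (hPQ : P ≠ Q) (hN : N ∈ line U V)
    (hP : P ∈ line U V) (hQ : Q ∈ line U V) : N ∈ line P Q := by
  rwa [line_eq_of_mem hPQ hP hQ]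

/-- Three lines meeting pairwise on a fixed line have a common point on that line. -/
lemma exists_common_point {L₁ L₂ L₃ : AffineSubspace ℝ Pt} {X Y : Pt}
    (h₁₂ : ∃ N, N ∈ L₁ ∧ N ∈ L₂ ∧ N ∈ line X Y) (h₁₃ : ∃ N, N ∈ L₁ ∧ N ∈ L₃ ∧ N ∈ line X Y)
    (h₂₃ : ∃ N, N ∈ L₂ ∧ N ∈ L₃ ∧ N ∈ line X Y) :
    ∃ N, N ∈ L₁ ∧ N ∈ L₂ ∧ N ∈ L₃ ∧ N ∈ line X Y := by
  obtain ⟨N, hN₁, hN₂, hN⟩ := h₁₂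
  obtain ⟨P, hP₁, hP₃, hP⟩ := h₁₃
  obtain ⟨Q, hQ₂, hQ₃, hQ⟩ := h₂₃
  by_cases hPQ : P = Q
  · exact ⟨P, hP₁, hPQ ▸ hQ₂, hP₃, hP⟩
  · exact ⟨N, hN₁, hN₂, line_le hP₃ hQ₃ (mem_line_of_collinear hPQ hN hP hQ), hN⟩

/-- Twice the signed area of a triangle. -/
def area (P Q R : Pt) : ℝ := (Q 0 - P 0) * (R 1 - P 1) - (Q 1 - P 1) * (R 0 - P 0)

lemma collinear_of_area_eq_zero {P Q R : Pt} (h : area P Q R = 0) :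
    Collinear ℝ ({P, Q, R} : Set Pt) := by
  by_cases hPQ : P = Q
  · subst hPQ
    simpa using collinear_pair ℝ P R
  have hR : R ∈ line P Q := by
    have h01 : Q 0 - P 0 ≠ 0 ∨ Q 1 - P 1 ≠ 0 := by
      by_contra! h'
      apply hPQ
      ext i
      fin_cases i
      · exact (sub_eq_zero.1 h'.1).symm
      · exact (sub_eq_zero.1 h'.2).symm
    unfold area at h
    rcases h01 with h0 | h0
    · refine mem_line.2 ⟨(R 0 - P 0) / (Q 0 - P 0), ?_⟩
      ext i
      fin_cases i <;> simp <;> field_simp <;> linarith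
    · refine mem_line.2 ⟨(R 1 - P 1) / (Q 1 - P 1), ?_⟩
      ext i
      fin_cases i <;> simp <;> field_simp <;> linarith
  have := collinear_insert_of_mem_affineSpan_pair (k := ℝ) hR
  convert this using 1
  ext
  simp
  tauto

lemma area_ne_zero {P Q R : Pt} (h : AffineIndependent ℝ ![P, Q, R]) : area P Q R ≠ 0 :=
  fun h0 => (affineIndependent_iff_not_collinear_set.1 h) (collinear_of_area_eq_zero h0)

lemma area_eq_zero_of_mem {P Q R U V : Pt} (hP : P ∈ line U V) (hQ : Q ∈ line U V)
    (hR : R ∈ line U V) : area P Q R = 0 := by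
  obtain ⟨p, rfl⟩ := mem_line.1 hP
  obtain ⟨q, rfl⟩ := mem_line.1 hQ
  obtain ⟨r, rfl⟩ := mem_line.1 hR
  simp [area]
  ring

lemma ne_of_area_ne_zero {P Q R : Pt} (h : area P Q R ≠ 0) : P ≠ Q ∧ P ≠ R ∧ Q ≠ R := by
  refine ⟨?_, ?_, ?_⟩ <;> rintro rfl <;> apply h <;> unfold area <;> ring

lemma desargues_aux {A₁ A₂ C₁ C₂ S Q : Pt} {t₁ t₂ : ℝ} (hA : A₁ ≠ A₂) (hC : C₁ ≠ C₂)
    (hne : line A₁ A₂ ≠ line C₁ C₂) (hSA : S ∈ line A₁ A₂) (hSC : S ∈ line C₁ C₂)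
    (h₁ : Q = A₁ + t₁ • (C₁ - A₁)) (h₂ : Q = A₂ + t₂ • (C₂ - A₂)) :
    t₁ ≠ t₂ ∧ (t₂ - t₁) • S = (1 - t₁) • A₁ - (1 - t₂) • A₂ := by
  obtain ⟨a, ha⟩ := mem_line.1 hSA
  obtain ⟨c, hc⟩ := mem_line.1 hSC
  set W := (1 - t₁) • A₁ - (1 - t₂) • A₂ - (t₂ - t₁) • S with hW
  have hWA : W = (t₂ - 1 - (t₂ - t₁) * a) • (A₂ - A₁) := by
    rw [hW, ha]; module
  have hWC : W = (t₂ - (t₂ - t₁) * c) • (C₂ - C₁) := by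
    have h : (1 - t₁) • A₁ - (1 - t₂) • A₂ = t₂ • C₂ - t₁ • C₁ := by
      have := h₁.symm.trans h₂
      linear_combination (norm := module) (1 : ℝ) • this
    rw [hW, h, hc]; module
  have hW0 : W = 0 := by
    by_contra hW0
    have hS : S ≠ S + W := by simpa using hW0
    apply hne
    rw [← line_eq_of_mem hS hSA, ← line_eq_of_mem hS hSC]
    · exact mem_line.2 ⟨c + (t₂ - (t₂ - t₁) * c), by rw [hWC]; nth_rw 1 [hc]; module⟩
    · exact mem_line.2 ⟨a + (t₂ - 1 - (t₂ - t₁) * a), by rw [hWA]; nth_rw 1 [ha]; module⟩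
  refine ⟨?_, (sub_eq_zero.1 hW0).symm⟩
  rintro rfl
  rw [hW0, sub_self, zero_mul, sub_zero, eq_comm, smul_eq_zero] at hWA hWC
  have h1 := hWA.resolve_right (sub_ne_zero.2 hA.symm)
  have h2 := hWC.resolve_right (sub_ne_zero.2 hC.symm)
  linarith

/-- Desargues' theorem for possibly degenerate triangles. -/
lemma desargues {A₁ A₂ A₃ C₁ C₂ C₃ S₁₂ S₁₃ S₂₃ Q : Pt}
    (hA₁₂ : A₁ ≠ A₂) (hA₁₃ : A₁ ≠ A₃) (hA₂₃ : A₂ ≠ A₃)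
    (hC₁₂ : C₁ ≠ C₂) (hC₁₃ : C₁ ≠ C₃) (hC₂₃ : C₂ ≠ C₃)
    (h₁₂ : line A₁ A₂ ≠ line C₁ C₂) (h₁₃ : line A₁ A₃ ≠ line C₁ C₃)
    (h₂₃ : line A₂ A₃ ≠ line C₂ C₃)
    (hS₁₂ : S₁₂ ∈ line A₁ A₂ ∧ S₁₂ ∈ line C₁ C₂)
    (hS₁₃ : S₁₃ ∈ line A₁ A₃ ∧ S₁₃ ∈ line C₁ C₃)
    (hS₂₃ : S₂₃ ∈ line A₂ A₃ ∧ S₂₃ ∈ line C₂ C₃)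
    (hQ₁ : Q ∈ line A₁ C₁) (hQ₂ : Q ∈ line A₂ C₂) (hQ₃ : Q ∈ line A₃ C₃) :
    Collinear ℝ ({S₁₂, S₁₃, S₂₃} : Set Pt) := by
  obtain ⟨t₁, ht₁⟩ := mem_line.1 hQ₁
  obtain ⟨t₂, ht₂⟩ := mem_line.1 hQ₂
  obtain ⟨t₃, ht₃⟩ := mem_line.1 hQ₃
  obtain ⟨hne, e₁₂⟩ := desargues_aux hA₁₂ hC₁₂ h₁₂ hS₁₂.1 hS₁₂.2 ht₁ ht₂
  obtain ⟨-, e₁₃⟩ := desargues_aux hA₁₃ hC₁₃ h₁₃ hS₁₃.1 hS₁₃.2 ht₁ ht₃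
  obtain ⟨-, e₂₃⟩ := desargues_aux hA₂₃ hC₂₃ h₂₃ hS₂₃.1 hS₂₃.2 ht₂ ht₃
  have hne' : t₂ - t₁ ≠ 0 := sub_ne_zero.2 hne.symm
  apply collinear_insert_of_mem_affineSpan_pair
  refine mem_line.2 ⟨-(t₃ - t₂) / (t₂ - t₁), smul_right_injective _ hne' ?_⟩
  have h : (t₂ - t₁) * (-(t₃ - t₂) / (t₂ - t₁)) = -(t₃ - t₂) := mul_div_cancel₀ _ hne'
  simp only [smul_add, smul_smul, h]
  linear_combination (norm := module) (1 : ℝ) • (e₁₂ - e₁₃ + e₂₃)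

lemma coord_eq {P U V : Pt} {t : ℝ} (h : P = U + t • (V - U)) (i : Fin 2) :
    P i = U i + t * (V i - U i) := by
  simp [h]

/-- The area form of Menelaus' theorem. -/
lemma area_menelaus {P R T N M Q : Pt} {n m q : ℝ} (hN : N = P + n • (R - P))
    (hM : M = R + m • (T - R)) (hQ : Q = T + q • (P - T)) :
    area N M Q = area P R T * (n * m * q + (1 - n) * (1 - m) * (1 - q)) := by
  simp only [area, coord_eq hN, coord_eq hM, coord_eq hQ]
  ring

lemma area_concurrent {P U V W N M Q : Pt} {n m q : ℝ} (hN : N = P + n • (U - P))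
    (hM : M = P + m • (V - P)) (hQ : Q = P + q • (W - P)) :
    area N M Q = n * m * area P U V + m * q * area P V W + q * n * area P W U := by
  simp only [area, coord_eq hN, coord_eq hM, coord_eq hQ]
  ring

lemma menelaus_scalar {a b c d e f n m q s t u : ℝ}
    (ha : a ≠ 0) (ha' : 1 - a ≠ 0) (hb : b ≠ 0) (hb' : 1 - b ≠ 0) (hc : c ≠ 0) (hc' : 1 - c ≠ 0)
    (hd : d ≠ 0) (hd' : 1 - d ≠ 0) (he : e ≠ 0) (he' : 1 - e ≠ 0) (hf : f ≠ 0) (hf' : 1 - f ≠ 0)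
    (hN : n * c * f + (1 - n) * (1 - c) * (1 - f) = 0)
    (hM : b * d * m + (1 - b) * (1 - d) * (1 - m) = 0)
    (hQ : a * q * e + (1 - a) * (1 - q) * (1 - e) = 0)
    (hNMQ : n * q * m + (1 - n) * (1 - q) * (1 - m) = 0)
    (h₁₂ : s * d * e + (1 - s) * (1 - d) * (1 - e) = 0)
    (h₁₃ : a * c * t + (1 - a) * (1 - c) * (1 - t) = 0)
    (h₂₃ : b * u * f + (1 - b) * (1 - u) * (1 - f) = 0) :
    s * u * t + (1 - s) * (1 - u) * (1 - t) = 0 := by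
  have hn : n ≠ 0 := by
    rintro rfl
    simp [hc', hf'] at hN
  have hm : m ≠ 0 := by
    rintro rfl
    simp [hb', hd'] at hM
  have hq : q ≠ 0 := by
    rintro rfl
    simp [ha', he'] at hQ
  have hK : a * b * c * d * e * f = (1 - a) * (1 - b) * (1 - c) * (1 - d) * (1 - e) * (1 - f) := by
    have hnqm : n * q * m ≠ 0 := by positivity
    have e₁ : n * c * f = -((1 - n) * (1 - c) * (1 - f)) := by linarith
    have e₂ : b * d * m = -((1 - b) * (1 - d) * (1 - m)) := by linarith
    have e₃ : a * q * e = -((1 - a) * (1 - q) * (1 - e)) := by linarith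
    have e₄ : (1 - n) * (1 - q) * (1 - m) = -(n * q * m) := by linarith
    apply mul_left_cancel₀ hnqm
    calc n * q * m * (a * b * c * d * e * f) = (n * c * f) * (b * d * m) * (a * q * e) := by ring
      _ = -((1 - n) * (1 - q) * (1 - m)) *
          ((1 - a) * (1 - b) * (1 - c) * (1 - d) * (1 - e) * (1 - f)) := by
        rw [e₁, e₂, e₃]; ring
      _ = _ := by rw [e₄]; ring
  have hK0 : a * b * c * d * e * f ≠ 0 := by positivity
  have e₁ : s * d * e = -((1 - s) * (1 - d) * (1 - e)) := by linarith
  have e₂ : a * c * t = -((1 - a) * (1 - c) * (1 - t)) := by linarith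
  have e₃ : b * u * f = -((1 - b) * (1 - u) * (1 - f)) := by linarith
  apply mul_left_cancel₀ hK0
  calc a * b * c * d * e * f * (s * u * t + (1 - s) * (1 - u) * (1 - t))
      = (s * d * e) * (a * c * t) * (b * u * f) +
        a * b * c * d * e * f * ((1 - s) * (1 - u) * (1 - t)) := by ring
    _ = 0 := by rw [e₁, e₂, e₃, hK]; ring
    _ = _ := by ring

lemma concurrent_scalar {a b c d e f n m q s t u x y z : ℝ}
    (ha : a ≠ 0) (hb : b ≠ 0) (hc : c ≠ 0) (hd : d ≠ 0) (he : e ≠ 0) (hf : f ≠ 0)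
    (hx : x ≠ 0) (hy : y ≠ 0) (hz : z ≠ 0)
    (hN : n * f * z + f * c * x + c * n * y = 0)
    (hM : b * m * z + m * d * x + d * b * y = 0)
    (hQ : a * e * z + e * q * x + q * a * y = 0)
    (hNMQ : n * m * z + m * q * x + q * n * y = 0)
    (h₁₂ : s * e * z + e * d * x + d * s * y = 0)
    (h₁₃ : a * t * z + t * c * x + c * a * y = 0)
    (h₂₃ : b * f * z + f * u * x + u * b * y = 0) :
    s * t * z + t * u * x + u * s * y = 0 := by
  have hn : n ≠ 0 := by
    rintro rfl
    simp [hf, hc, hx] at hN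
  have hm : m ≠ 0 := by
    rintro rfl
    simp [hd, hb, hy] at hM
  have hq : q ≠ 0 := by
    rintro rfl
    simp [ha, he, hz] at hQ
  have hs : s ≠ 0 := by
    rintro rfl
    simp [hd, he, hx] at h₁₂
  have ht : t ≠ 0 := by
    rintro rfl
    simp [hc, ha, hy] at h₁₃
  have hu : u ≠ 0 := by
    rintro rfl
    simp [hb, hf, hz] at h₂₃
  have aux : ∀ {α β γ : ℝ}, α ≠ 0 → β ≠ 0 → γ ≠ 0 →
      (α * β * z + β * γ * x + γ * α * y = 0 ↔ z / γ + x / α + y / β = 0) := by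
    intro α β γ hα hβ hγ
    have h : α * β * z + β * γ * x + γ * α * y = α * β * γ * (z / γ + x / α + y / β) := by
      field_simp
    rw [h, mul_eq_zero]
    simp [hα, hβ, hγ]
  rw [aux hn hf hc] at hN
  rw [aux hb hm hd] at hM
  rw [aux ha he hq] at hQ
  rw [aux hn hm hq] at hNMQ
  rw [aux hs he hd] at h₁₂
  rw [aux ha ht hc] at h₁₃
  rw [aux hb hf hu] at h₂₃
  rw [aux hs ht hu]
  linarith

lemma param_ne {U V P : Pt} {t : ℝ} (h : P = U + t • (V - U)) (hU : P ≠ U) (hV : P ≠ V) :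
    t ≠ 0 ∧ 1 - t ≠ 0 := by
  refine ⟨?_, fun h1 => hV ?_⟩
  · rintro rfl
    exact hU (by simpa using h)
  · rw [h, ← sub_eq_zero.1 h1]
    simp

/-- The configuration in which Desargues' theorem degenerates for each pair of vertices. -/
lemma collinear_of_degenerate {A₁ B₁ C₁ A₂ B₂ C₂ A₃ B₃ C₃ S₁₂ S₁₃ S₂₃ X Y N M Q : Pt}
    (hT₁ : area A₁ B₁ C₁ ≠ 0) (hT₂ : area A₂ B₂ C₂ ≠ 0) (hT₃ : area A₃ B₃ C₃ ≠ 0)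
    (hA₁₂ : A₁ ≠ A₂) (hB₁₂ : B₁ ≠ B₂) (hB₁₃ : B₁ ≠ B₃)
    (hC₁₃ : C₁ ≠ C₃) (hA₂₃ : A₂ ≠ A₃) (hC₂₃ : C₂ ≠ C₃)
    (h₁₂ : line A₁ A₂ = line B₁ B₂) (h₁₃ : line B₁ B₃ = line C₁ C₃)
    (h₂₃ : line A₂ A₃ = line C₂ C₃)
    (hS₁₂ : S₁₂ ∈ line A₁ A₂ ∧ S₁₂ ∈ line B₁ B₂ ∧ S₁₂ ∈ line C₁ C₂)
    (hS₁₃ : S₁₃ ∈ line A₁ A₃ ∧ S₁₃ ∈ line B₁ B₃ ∧ S₁₃ ∈ line C₁ C₃)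
    (hS₂₃ : S₂₃ ∈ line A₂ A₃ ∧ S₂₃ ∈ line B₂ B₃ ∧ S₂₃ ∈ line C₂ C₃)
    (hN : N ∈ line A₁ B₁ ∧ N ∈ line A₂ B₂ ∧ N ∈ line A₃ B₃ ∧ N ∈ line X Y)
    (hM : M ∈ line B₁ C₁ ∧ M ∈ line B₂ C₂ ∧ M ∈ line B₃ C₃ ∧ M ∈ line X Y)
    (hQ : Q ∈ line C₁ A₁ ∧ Q ∈ line C₂ A₂ ∧ Q ∈ line C₃ A₃ ∧ Q ∈ line X Y) :
    Collinear ℝ ({S₁₂, S₁₃, S₂₃} : Set Pt) := by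
  have hA₁ : A₁ ∈ line B₁ B₂ := h₁₂ ▸ left_mem_line_s12 _ _
  have hA₂ : A₂ ∈ line B₁ B₂ := h₁₂ ▸ right_mem_line_s12 _ _
  have hB₁ : B₁ ∈ line C₁ C₃ := h₁₃ ▸ left_mem_line_s12 _ _
  have hB₃ : B₃ ∈ line C₁ C₃ := h₁₃ ▸ right_mem_line_s12 _ _
  have hA₂' : A₂ ∈ line C₂ C₃ := h₂₃ ▸ left_mem_line_s12 _ _
  have hA₃ : A₃ ∈ line C₂ C₃ := h₂₃ ▸ right_mem_line_s12 _ _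
  have hN' : N ∈ line B₁ B₂ := line_le hA₁ (left_mem_line_s12 _ _) hN.1
  have hM' : M ∈ line C₁ C₃ := line_le hB₁ (left_mem_line_s12 _ _) hM.1
  have hQ' : Q ∈ line C₂ C₃ := line_le (left_mem_line_s12 _ _) hA₂' hQ.2.1
  have hca : line B₁ B₂ ≠ line C₁ C₃ := fun h =>
    hT₁ (area_eq_zero_of_mem (h ▸ hA₁) hB₁ (left_mem_line_s12 _ _))
  have hcb : line B₁ B₂ ≠ line C₂ C₃ := fun h =>
    hT₂ (area_eq_zero_of_mem hA₂' (h ▸ right_mem_line_s12 _ _) (left_mem_line_s12 _ _))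
  have hab : line C₁ C₃ ≠ line C₂ C₃ := fun h =>
    hT₃ (area_eq_zero_of_mem hA₃ (h ▸ hB₃) (right_mem_line_s12 _ _))
  have eN := area_eq_zero_of_mem hN.2.2.1 (left_mem_line_s12 _ _) (right_mem_line_s12 _ _)
  have eM := area_eq_zero_of_mem (left_mem_line_s12 _ _) (right_mem_line_s12 _ _) hM.2.1
  have eQ := area_eq_zero_of_mem (right_mem_line_s12 _ _) hQ.1 (left_mem_line_s12 _ _)
  have eX := area_eq_zero_of_mem hN.2.2.2 hQ.2.2.2 hM.2.2.2
  have e₁₂ := area_eq_zero_of_mem hS₁₂.2.2 (right_mem_line_s12 _ _) (left_mem_line_s12 _ _)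
  have e₁₃ := area_eq_zero_of_mem (left_mem_line_s12 _ _) (right_mem_line_s12 _ _) hS₁₃.1
  have e₂₃ := area_eq_zero_of_mem (left_mem_line_s12 _ _) hS₂₃.2.1 (right_mem_line_s12 _ _)
  have hflip : ∀ {P Q R : Pt}, area P Q R = -area P R Q := by
    intros
    unfold area
    ring
  apply collinear_of_area_eq_zero
  rw [hflip, neg_eq_zero]
  by_cases hPT : B₁ = C₃
  · have hPR : B₁ = A₂ := by
      by_contra h
      exact hcb ((line_eq_of_mem h (left_mem_line_s12 _ _) hA₂).symm.trans
        (line_eq_of_mem h (hPT ▸ right_mem_line_s12 _ _) hA₂'))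
    subst hPT hPR
    rw [line_comm_s12] at hB₃ hA₃ hM' hQ'
    obtain ⟨a, pA₁⟩ := mem_line.1 hA₁
    obtain ⟨n, pN⟩ := mem_line.1 hN'
    obtain ⟨s, pS⟩ := mem_line.1 hS₁₂.2.1
    obtain ⟨c, pA₃⟩ := mem_line.1 hA₃
    obtain ⟨q, pQ⟩ := mem_line.1 hQ'
    obtain ⟨u, pU⟩ := mem_line.1 (line_comm_s12 C₂ B₁ ▸ hS₂₃.2.2)
    obtain ⟨f, pB₃⟩ := mem_line.1 hB₃
    obtain ⟨m, pM⟩ := mem_line.1 hM'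
    obtain ⟨t, pT⟩ := mem_line.1 (line_comm_s12 C₁ B₁ ▸ hS₁₃.2.2)
    have pB₂ : B₂ = B₁ + (1 : ℝ) • (B₂ - B₁) := by simp
    have pC₁ : C₁ = B₁ + (1 : ℝ) • (C₁ - B₁) := by simp
    have pC₂ : C₂ = B₁ + (1 : ℝ) • (C₂ - B₁) := by simp
    have hz : area A₁ B₁ C₁ = -(a * area B₁ B₂ C₁) := by
      simp only [area, coord_eq pA₁]; ring
    have hy : area B₁ B₂ C₂ = -area B₁ C₂ B₂ := hflip
    have hx : area A₃ B₃ B₁ = -(c * f * area B₁ C₁ C₂) := by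
      simp only [area, coord_eq pA₃, coord_eq pB₃]; ring
    rw [hz, neg_ne_zero, mul_ne_zero_iff] at hT₁
    rw [hy, neg_ne_zero] at hT₂
    rw [hx, neg_ne_zero, mul_ne_zero_iff, mul_ne_zero_iff] at hT₃
    rw [hflip, neg_eq_zero, area_concurrent pN pB₃ pA₃] at eN
    rw [hflip, neg_eq_zero, area_concurrent pB₂ pM pC₂] at eM
    rw [hflip, neg_eq_zero, area_concurrent pA₁ pC₁ pQ] at eQ
    rw [hflip, neg_eq_zero, area_concurrent pN pM pQ] at eX
    rw [hflip, neg_eq_zero, area_concurrent pS pC₁ pC₂] at e₁₂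
    rw [hflip, neg_eq_zero, area_concurrent pA₁ pT pA₃] at e₁₃
    rw [hflip, neg_eq_zero, area_concurrent pB₂ pB₃ pU] at e₂₃
    rw [hflip, neg_eq_zero, area_concurrent pS pT pU]
    exact concurrent_scalar hT₁.1 one_ne_zero hT₃.1.1 one_ne_zero one_ne_zero hT₃.1.2
      hT₃.2 hT₂ hT₁.2 eN eM eQ eX e₁₂ e₁₃ e₂₃
  have hPR : B₁ ≠ A₂ := fun h => hab ((line_eq_of_mem hPT hB₁ (right_mem_line_s12 _ _)).symm.trans
    (line_eq_of_mem hPT (h ▸ hA₂') (right_mem_line_s12 _ _)))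
  have hRT : A₂ ≠ C₃ := fun h => hca ((line_eq_of_mem hPR (left_mem_line_s12 _ _) hA₂).symm.trans
    (line_eq_of_mem hPR hB₁ (h ▸ right_mem_line_s12 _ _)))
  have hc := line_eq_of_mem hPR (left_mem_line_s12 _ _) hA₂
  have hb := line_eq_of_mem hRT hA₂' (right_mem_line_s12 _ _)
  have ha := line_eq_of_mem (Ne.symm hPT) (right_mem_line_s12 _ _) hB₁
  have hB₂ := right_mem_line_s12 B₁ B₂
  have hC₂ := left_mem_line_s12 C₂ C₃
  have hC₁ := left_mem_line_s12 C₁ C₃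
  rw [← hc] at hA₁ hB₂ hN'
  rw [← hb] at hA₃ hC₂ hQ'
  rw [← ha] at hC₁ hB₃ hM'
  have hs := hS₁₂.2.1
  have ht := hS₁₃.2.2
  have hu := hS₂₃.2.2
  rw [← hc] at hs
  rw [← ha] at ht
  rw [← hb] at hu
  obtain ⟨a, pA₁⟩ := mem_line.1 hA₁
  obtain ⟨b, pB₂⟩ := mem_line.1 hB₂
  obtain ⟨n, pN⟩ := mem_line.1 hN'
  obtain ⟨s, pS⟩ := mem_line.1 hs
  obtain ⟨c, pA₃⟩ := mem_line.1 hA₃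
  obtain ⟨d, pC₂⟩ := mem_line.1 hC₂
  obtain ⟨q, pQ⟩ := mem_line.1 hQ'
  obtain ⟨u, pU⟩ := mem_line.1 hu
  obtain ⟨e, pC₁⟩ := mem_line.1 hC₁
  obtain ⟨f, pB₃⟩ := mem_line.1 hB₃
  obtain ⟨m, pM⟩ := mem_line.1 hM'
  obtain ⟨t, pT⟩ := mem_line.1 ht
  have hD : area B₁ A₂ C₃ ≠ 0 := by
    intro hD
    apply hT₁
    rw [show area A₁ B₁ C₁ = -(a * (1 - e) * area B₁ A₂ C₃) by
      simp only [area, coord_eq pA₁, coord_eq pC₁]; ring, hD]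
    simp
  rw [area_menelaus pN pA₃ pB₃] at eN
  rw [area_menelaus pB₂ pC₂ pM] at eM
  rw [area_menelaus pA₁ pQ pC₁] at eQ
  rw [area_menelaus pN pQ pM] at eX
  rw [area_menelaus pS pC₂ pC₁] at e₁₂
  rw [area_menelaus pA₁ pA₃ pT] at e₁₃
  rw [area_menelaus pB₂ pU pB₃] at e₂₃
  rw [area_menelaus pS pU pT]
  simp only [mul_eq_zero, hD, false_or] at eN eM eQ eX e₁₂ e₁₃ e₂₃ ⊢
  obtain ⟨hA₁B₁, -, hC₁B₁⟩ := ne_of_area_ne_zero hT₁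
  obtain ⟨hA₂B₂, hA₂C₂, -⟩ := ne_of_area_ne_zero hT₂
  obtain ⟨-, hA₃C₃, hB₃C₃⟩ := ne_of_area_ne_zero hT₃
  obtain ⟨ha₀, ha₁⟩ := param_ne pA₁ hA₁B₁ hA₁₂
  obtain ⟨hb₀, hb₁⟩ := param_ne pB₂ hB₁₂.symm hA₂B₂.symm
  obtain ⟨hc₀, hc₁⟩ := param_ne pA₃ hA₂₃.symm hA₃C₃
  obtain ⟨hd₀, hd₁⟩ := param_ne pC₂ hA₂C₂.symm hC₂₃
  obtain ⟨he₀, he₁⟩ := param_ne pC₁ hC₁₃ hC₁B₁.symm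
  obtain ⟨hf₀, hf₁⟩ := param_ne pB₃ hB₃C₃ hB₁₃.symm
  exact menelaus_scalar ha₀ ha₁ hb₀ hb₁ hc₀ hc₁ hd₀ hd₁ he₀ he₁ hf₀ hf₁ eN eM eQ eX e₁₂ e₁₃ e₂₃

lemma lines_not_all_eq {A B C A' B' C' : Pt} (h : area A B C ≠ 0)
    (hAB : line A A' = line B B') (hBC : line B B' = line C C') : False :=
  h (area_eq_zero_of_mem (hAB ▸ left_mem_line_s12 A A') (left_mem_line_s12 B B')
    (hBC ▸ left_mem_line_s12 C C'))

/-- **Lemma used in Problem 2, part iv.** If three nondegenerate triangles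
`A₁B₁C₁`, `A₂B₂C₂`, `A₃B₃C₃` are pairwise homological, with homology centers
`S₁₂`, `S₁₃`, `S₂₃`, and the three pairs share the same homology axis — a line
`ℓ = line X Y` containing the intersection points of all corresponding sides —
then the three homology centers are collinear. -/
theorem homology_centers_collinear
    (A₁ B₁ C₁ A₂ B₂ C₂ A₃ B₃ C₃ S₁₂ S₁₃ S₂₃ X Y : Pt)
    (hT₁ : AffineIndependent ℝ ![A₁, B₁, C₁])
    (hT₂ : AffineIndependent ℝ ![A₂, B₂, C₂])
    (hT₃ : AffineIndependent ℝ ![A₃, B₃, C₃])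
    (hA₁₂ : A₁ ≠ A₂) (hB₁₂ : B₁ ≠ B₂) (hC₁₂ : C₁ ≠ C₂)
    (hA₁₃ : A₁ ≠ A₃) (hB₁₃ : B₁ ≠ B₃) (hC₁₃ : C₁ ≠ C₃)
    (hA₂₃ : A₂ ≠ A₃) (hB₂₃ : B₂ ≠ B₃) (hC₂₃ : C₂ ≠ C₃)
    (hS₁₂ : S₁₂ ∈ line A₁ A₂ ∧ S₁₂ ∈ line B₁ B₂ ∧ S₁₂ ∈ line C₁ C₂)
    (hS₁₃ : S₁₃ ∈ line A₁ A₃ ∧ S₁₃ ∈ line B₁ B₃ ∧ S₁₃ ∈ line C₁ C₃)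
    (hS₂₃ : S₂₃ ∈ line A₂ A₃ ∧ S₂₃ ∈ line B₂ B₃ ∧ S₂₃ ∈ line C₂ C₃)
    (hXY : X ≠ Y)
    (hax₁₂ : (∃ N, N ∈ line A₁ B₁ ∧ N ∈ line A₂ B₂ ∧ N ∈ line X Y) ∧
             (∃ M, M ∈ line B₁ C₁ ∧ M ∈ line B₂ C₂ ∧ M ∈ line X Y) ∧
             (∃ Q, Q ∈ line C₁ A₁ ∧ Q ∈ line C₂ A₂ ∧ Q ∈ line X Y))
    (hax₁₃ : (∃ N, N ∈ line A₁ B₁ ∧ N ∈ line A₃ B₃ ∧ N ∈ line X Y) ∧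
             (∃ M, M ∈ line B₁ C₁ ∧ M ∈ line B₃ C₃ ∧ M ∈ line X Y) ∧
             (∃ Q, Q ∈ line C₁ A₁ ∧ Q ∈ line C₃ A₃ ∧ Q ∈ line X Y))
    (hax₂₃ : (∃ N, N ∈ line A₂ B₂ ∧ N ∈ line A₃ B₃ ∧ N ∈ line X Y) ∧
             (∃ M, M ∈ line B₂ C₂ ∧ M ∈ line B₃ C₃ ∧ M ∈ line X Y) ∧
             (∃ Q, Q ∈ line C₂ A₂ ∧ Q ∈ line C₃ A₃ ∧ Q ∈ line X Y)) :
    Collinear ℝ ({S₁₂, S₁₃, S₂₃} : Set Pt) := by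
  replace hT₁ := area_ne_zero hT₁
  replace hT₂ := area_ne_zero hT₂
  replace hT₃ := area_ne_zero hT₃
  obtain ⟨N, hN₁, hN₂, hN₃, hN⟩ := exists_common_point hax₁₂.1 hax₁₃.1 hax₂₃.1
  obtain ⟨M, hM₁, hM₂, hM₃, hM⟩ := exists_common_point hax₁₂.2.1 hax₁₃.2.1 hax₂₃.2.1
  obtain ⟨Q, hQ₁, hQ₂, hQ₃, hQ⟩ := exists_common_point hax₁₂.2.2 hax₁₃.2.2 hax₂₃.2.2
  by_contra hcol
  have hAB : line A₁ A₂ = line B₁ B₂ ∨ line A₁ A₃ = line B₁ B₃ ∨ line A₂ A₃ = line B₂ B₃ := by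
    by_contra! h
    exact hcol (desargues hA₁₂ hA₁₃ hA₂₃ hB₁₂ hB₁₃ hB₂₃ h.1 h.2.1 h.2.2 ⟨hS₁₂.1, hS₁₂.2.1⟩
      ⟨hS₁₃.1, hS₁₃.2.1⟩ ⟨hS₂₃.1, hS₂₃.2.1⟩ hN₁ hN₂ hN₃)
  have hBC : line B₁ B₂ = line C₁ C₂ ∨ line B₁ B₃ = line C₁ C₃ ∨ line B₂ B₃ = line C₂ C₃ := by
    by_contra! h
    exact hcol (desargues hB₁₂ hB₁₃ hB₂₃ hC₁₂ hC₁₃ hC₂₃ h.1 h.2.1 h.2.2 hS₁₂.2 hS₁₃.2 hS₂₃.2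
      hM₁ hM₂ hM₃)
  have hCA : line C₁ C₂ = line A₁ A₂ ∨ line C₁ C₃ = line A₁ A₃ ∨ line C₂ C₃ = line A₂ A₃ := by
    by_contra! h
    exact hcol (desargues hC₁₂ hC₁₃ hC₂₃ hA₁₂ hA₁₃ hA₂₃ h.1 h.2.1 h.2.2 ⟨hS₁₂.2.2, hS₁₂.1⟩
      ⟨hS₁₃.2.2, hS₁₃.1⟩ ⟨hS₂₃.2.2, hS₂₃.1⟩ hQ₁ hQ₂ hQ₃)
  have hne₁₂ : ¬(line A₁ A₂ = line B₁ B₂ ∧ line B₁ B₂ = line C₁ C₂) := fun h =>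
    lines_not_all_eq hT₁ h.1 h.2
  have hne₁₃ : ¬(line A₁ A₃ = line B₁ B₃ ∧ line B₁ B₃ = line C₁ C₃) := fun h =>
    lines_not_all_eq hT₁ h.1 h.2
  have hne₂₃ : ¬(line A₂ A₃ = line B₂ B₃ ∧ line B₂ B₃ = line C₂ C₃) := fun h =>
    lines_not_all_eq hT₂ h.1 h.2
  have hS₂₁ : S₁₂ ∈ line A₂ A₁ ∧ S₁₂ ∈ line B₂ B₁ ∧ S₁₂ ∈ line C₂ C₁ := by
    rwa [line_comm_s12 A₂, line_comm_s12 B₂, line_comm_s12 C₂]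
  have hS₃₁ : S₁₃ ∈ line A₃ A₁ ∧ S₁₃ ∈ line B₃ B₁ ∧ S₁₃ ∈ line C₃ C₁ := by
    rwa [line_comm_s12 A₃, line_comm_s12 B₃, line_comm_s12 C₃]
  have hS₃₂ : S₂₃ ∈ line A₃ A₂ ∧ S₂₃ ∈ line B₃ B₂ ∧ S₂₃ ∈ line C₃ C₂ := by
    rwa [line_comm_s12 A₃, line_comm_s12 B₃, line_comm_s12 C₃]
  have flip : ∀ {P Q R S : Pt}, line P Q = line R S → line Q P = line S R := fun h => by
    rw [line_comm_s12, h, line_comm_s12]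
  have h₁₂₃ : line A₁ A₂ = line B₁ B₂ → line B₁ B₃ = line C₁ C₃ →
      ¬line C₂ C₃ = line A₂ A₃ := fun h h' h'' =>
    hcol <| collinear_of_degenerate hT₁ hT₂ hT₃ hA₁₂ hB₁₂ hB₁₃ hC₁₃
      hA₂₃ hC₂₃ h h' h''.symm hS₁₂ hS₁₃ hS₂₃
      ⟨hN₁, hN₂, hN₃, hN⟩ ⟨hM₁, hM₂, hM₃, hM⟩ ⟨hQ₁, hQ₂, hQ₃, hQ⟩
  have h₁₃₂ : line A₁ A₃ = line B₁ B₃ → line B₁ B₂ = line C₁ C₂ →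
      ¬line C₂ C₃ = line A₂ A₃ := fun h h' h'' => hcol <| by
    rw [Set.insert_comm]
    exact collinear_of_degenerate hT₁ hT₃ hT₂ hA₁₃ hB₁₃ hB₁₂ hC₁₂
      hA₂₃.symm hC₂₃.symm h h' (flip h''.symm) hS₁₃ hS₁₂ hS₃₂
      ⟨hN₁, hN₃, hN₂, hN⟩ ⟨hM₁, hM₃, hM₂, hM⟩ ⟨hQ₁, hQ₃, hQ₂, hQ⟩
  have h₂₁₃ : line A₁ A₂ = line B₁ B₂ → line B₂ B₃ = line C₂ C₃ →
      ¬line C₁ C₃ = line A₁ A₃ := fun h h' h'' => hcol <| by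
    rw [Set.pair_comm S₁₃]
    exact collinear_of_degenerate hT₂ hT₁ hT₃ hA₁₂.symm hB₁₂.symm hB₂₃ hC₂₃
      hA₁₃ hC₁₃ (flip h) h' h''.symm hS₂₁ hS₂₃ hS₁₃
      ⟨hN₂, hN₁, hN₃, hN⟩ ⟨hM₂, hM₁, hM₃, hM⟩ ⟨hQ₂, hQ₁, hQ₃, hQ⟩
  have h₂₃₁ : line A₂ A₃ = line B₂ B₃ → line B₁ B₂ = line C₁ C₂ →
      ¬line C₁ C₃ = line A₁ A₃ := fun h h' h'' => hcol <| by
    rw [Set.pair_comm S₁₃, Set.insert_comm]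
    exact collinear_of_degenerate hT₂ hT₃ hT₁ hA₂₃ hB₂₃ hB₁₂.symm hC₁₂.symm
      hA₁₃.symm hC₁₃.symm h (flip h') (flip h''.symm) hS₂₃ hS₂₁ hS₃₁
      ⟨hN₂, hN₃, hN₁, hN⟩ ⟨hM₂, hM₃, hM₁, hM⟩ ⟨hQ₂, hQ₃, hQ₁, hQ⟩
  have h₃₁₂ : line A₁ A₃ = line B₁ B₃ → line B₂ B₃ = line C₂ C₃ →
      ¬line C₁ C₂ = line A₁ A₂ := fun h h' h'' => hcol <| by
    rw [Set.insert_comm, Set.pair_comm S₁₂]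
    exact collinear_of_degenerate hT₃ hT₁ hT₂ hA₁₃.symm hB₁₃.symm hB₂₃.symm hC₂₃.symm
      hA₁₂ hC₁₂ (flip h) (flip h') h''.symm hS₃₁ hS₃₂ hS₁₂
      ⟨hN₃, hN₁, hN₂, hN⟩ ⟨hM₃, hM₁, hM₂, hM⟩ ⟨hQ₃, hQ₁, hQ₂, hQ⟩
  have h₃₂₁ : line A₂ A₃ = line B₂ B₃ → line B₁ B₃ = line C₁ C₃ →
      ¬line C₁ C₂ = line A₁ A₂ := fun h h' h'' => hcol <| by
    rw [Set.insert_comm, Set.pair_comm S₁₂, Set.insert_comm]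
    exact collinear_of_degenerate hT₃ hT₂ hT₁ hA₂₃.symm hB₂₃.symm hB₁₃.symm hC₁₃.symm
      hA₁₂.symm hC₁₂.symm (flip h) (flip h') (flip h''.symm) hS₃₂ hS₃₁ hS₂₁
      ⟨hN₃, hN₂, hN₁, hN⟩ ⟨hM₃, hM₂, hM₁, hM⟩ ⟨hQ₃, hQ₂, hQ₁, hQ⟩
  have excl : ∀ {U V U' V' U'' V'' : Pt}, ¬(line U V = line U' V' ∧ line U' V' = line U'' V'') →
      (line U V = line U' V' → ¬line U'' V'' = line U V) ∧
      (line U' V' = line U'' V'' → ¬line U'' V'' = line U V) := fun hne =>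
    ⟨fun h h'' => hne ⟨h, (h''.trans h).symm⟩, fun h' h'' => hne ⟨(h'.trans h'').symm, h'⟩⟩
  rcases hAB with h | h | h <;> rcases hBC with h' | h' | h' <;>
    rcases hCA with h'' | h'' | h'' <;>
    first
    | exact h₁₂₃ h h' h'' | exact h₁₃₂ h h' h'' | exact h₂₁₃ h h' h''
    | exact h₂₃₁ h h' h'' | exact h₃₁₂ h h' h'' | exact h₃₂₁ h h' h''
    | exact hne₁₂ ⟨h, h'⟩ | exact hne₁₃ ⟨h, h'⟩ | exact hne₂₃ ⟨h, h'⟩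
    | exact (excl hne₁₂).1 h h'' | exact (excl hne₁₃).1 h h'' | exact (excl hne₂₃).1 h h''
    | exact (excl hne₁₂).2 h' h'' | exact (excl hne₁₃).2 h' h'' | exact (excl hne₂₃).2 h' h''
end

section
/- (Problem 2, part v) Let ABCD be a convex quadrilateral (no three vertices collinear) in the real affine plane with E = AB ∩ CD, F = BC ∩ AD, P = BD ∩ EF, R = AC ∩ EF, O = AC ∩ BD all existing. Let M, N, Q be the midpoints of CE, BE, BC and U, V, T the midpoints of CF, DF, DC, with triangles POR, MNQ, UVT nondegenerate. Let S₁ be the homology center of the pair (MNQ, POR) (the common point of lines QO, MR, NP), S₂ the homology center of the pair (UVT, POR) (the common point of lines TO, UR, VP), and S₃ the homology center of the pair (MNQ, UVT) (the common point of lines MU, QT, NV). Then S₁, S₂, S₃ are collinear. -/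
/-- The line condition in coordinates: affine functionals `x`, `y` satisfy the two-point equation
of a line at each of its points. -/
theorem cross_eq_of_mem_line {X Y Z : Pt} (h : Z ∈ line X Y) (x y : Pt →ᵃ[ℝ] ℝ) :
    (x Z - x X) * (y Y - y X) = (y Z - y X) * (x Y - x X) := by
  obtain ⟨t, rfl⟩ := mem_affineSpan_pair_iff_exists_lineMap_eq.1 h
  simp only [AffineMap.apply_lineMap, AffineMap.lineMap_apply_ring']
  ring

theorem map_midpoint_real (x : Pt →ᵃ[ℝ] ℝ) (X Y : Pt) :
    x (midpoint ℝ X Y) = (x X + x Y) / 2 := by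
  rw [AffineMap.map_midpoint, midpoint_eq_smul_add, smul_eq_mul, invOf_eq_inv]
  ring

/-- Three non-collinear points of the plane provide affine coordinates in which collinearity is
detected by a determinant. -/
theorem exists_affine_coordinates {B C D : Pt} (h : ¬ Collinear ℝ ({B, C, D} : Set Pt)) :
    ∃ x y : Pt →ᵃ[ℝ] ℝ, x B = 1 ∧ y B = 0 ∧ x C = 0 ∧ y C = 0 ∧ x D = 0 ∧ y D = 1 ∧
      ∀ X Y Z : Pt, (x Y - x X) * (y Z - y X) = (y Y - y X) * (x Z - x X) →
        Collinear ℝ ({X, Y, Z} : Set Pt) := by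
  have hi : AffineIndependent ℝ ![B, C, D] := affineIndependent_iff_not_collinear_set.2 h
  have hs : affineSpan ℝ (Set.range ![B, C, D]) = ⊤ :=
    hi.affineSpan_eq_top_iff_card_eq_finrank_add_one.2 (by simp)
  let b : AffineBasis (Fin 3) ℝ Pt := ⟨![B, C, D], hi, hs⟩
  have hb0 : B = b 0 := rfl
  have hb1 : C = b 1 := rfl
  have hb2 : D = b 2 := rfl
  refine ⟨b.coord 0, b.coord 2, ?_, ?_, ?_, ?_, ?_, ?_, ?_⟩
  iterate 6 simp [hb0, hb1, hb2]
  intro X Y Z hd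
  by_contra hn
  have hp : AffineIndependent ℝ ![X, Y, Z] := affineIndependent_iff_not_collinear_set.2 hn
  have ht : affineSpan ℝ (Set.range ![X, Y, Z]) = ⊤ :=
    hp.affineSpan_eq_top_iff_card_eq_finrank_add_one.2 (by simp)
  have hu := (b.isUnit_toMatrix_iff ![X, Y, Z]).2 ⟨hp, ht⟩
  rw [Matrix.isUnit_iff_isUnit_det, isUnit_iff_ne_zero] at hu
  apply hu
  have hsum (P : Pt) : b.coord 1 P = 1 - b.coord 0 P - b.coord 2 P := by
    have := b.sum_coord_apply_eq_one P
    rw [Fin.sum_univ_three] at this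
    linarith
  rw [Matrix.det_fin_three]
  simp only [AffineBasis.toMatrix_apply, Matrix.cons_val, hsum]
  linear_combination -hd

/-- If `(x, y)` lies on the line through `(1/2, 0)` and `O`, and on the line through `(0, e/2)` and
`R`, then its coordinates are explicit fractions with nonzero denominator. -/
theorem homology_center_coordinates {a b e f xO yO xR yR x y : ℝ} (ha : a ≠ 0) (hb : b ≠ 0)
    (he : e * (1 - a) = b) (hf : f * (1 - b) = a)
    (hO : b * xO = a * yO) (hO' : xO + yO = 1)
    (hR : b * xR = a * yR) (hR' : e * xR + f * yR = e * f)
    (h₁ : (x - 1 / 2) * yO = y * (xO - 1 / 2))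
    (h₂ : x * (yR - e / 2) = (y - e / 2) * xR) :
    (a - b) ^ 2 + 4 * a * (1 - a) ≠ 0 ∧
      ((a - b) ^ 2 + 4 * a * (1 - a)) * x = a * (2 - a - b) ∧
      ((a - b) ^ 2 + 4 * a * (1 - a)) * y = b * (a + b) := by
  have ha1 : 1 - a ≠ 0 := by rintro h; rw [h, mul_zero] at he; exact hb he.symm
  have hb1 : 1 - b ≠ 0 := by rintro h; rw [h, mul_zero] at hf; exact ha hf.symm
  obtain rfl : e = b / (1 - a) := by field_simp; exact he
  obtain rfl : f = a / (1 - b) := by field_simp; exact hf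
  have hx : (a + b) * xO = a := by linear_combination hO + a * hO'
  have hab : a + b ≠ 0 := by rintro h; rw [h, zero_mul] at hx; exact ha hx.symm
  have hxR : (2 - a - b) * xR = a := by
    field_simp at hR'
    refine mul_left_cancel₀ hb ?_
    linear_combination hR' + (1 - a) * hR
  have hs : 2 - a - b ≠ 0 := by rintro h; rw [h, zero_mul] at hxR; exact ha hxR.symm
  obtain rfl : xO = a / (a + b) := by field_simp; linear_combination hx
  obtain rfl : yO = b / (a + b) := by
    refine mul_left_cancel₀ ha ?_
    rw [← hO]; ring
  obtain rfl : xR = a / (2 - a - b) := by field_simp; linear_combination hxR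
  obtain rfl : yR = b / (2 - a - b) := by
    refine mul_left_cancel₀ ha ?_
    rw [← hR]; ring
  have l₁ : 2 * b * x - (a - b) * y = b := by
    field_simp at h₁
    linear_combination h₁
  have l₂ : b * (a - b) * x + 2 * a * (1 - a) * y = a * b := by
    field_simp at h₂
    linear_combination -h₂
  have hx : ((a - b) ^ 2 + 4 * a * (1 - a)) * x = a * (2 - a - b) := by
    refine mul_left_cancel₀ hb ?_
    linear_combination 2 * a * (1 - a) * l₁ + (a - b) * l₂
  have hy : ((a - b) ^ 2 + 4 * a * (1 - a)) * y = b * (a + b) := by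
    refine mul_left_cancel₀ hb ?_
    linear_combination 2 * b * l₂ - b * (a - b) * l₁
  refine ⟨fun h ↦ ?_, hx, hy⟩
  rw [h, zero_mul] at hx
  exact mul_ne_zero ha hs hx.symm

/-- **Problem 2, part v.** In the complete quadrilateral `ABCDEF` with diagonal triangle
`POR`, let `M`, `N`, `Q` be the midpoints of `CE`, `BE`, `BC` and `U`, `V`, `T` the
midpoints of `CF`, `DF`, `DC`. If `S₁` is the homology center of `(MNQ, POR)`, `S₂`
that of `(UVT, POR)`, and `S₃` that of `(MNQ, UVT)`, then `S₁`, `S₂`, `S₃` are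
collinear. -/
theorem problem2_v (A B C D E F P R O M N Q U V T S₁ S₂ S₃ : Pt)
    (h₁ : ¬ Collinear ℝ ({A, B, C} : Set Pt))
    (h₂ : ¬ Collinear ℝ ({A, B, D} : Set Pt))
    (h₃ : ¬ Collinear ℝ ({A, C, D} : Set Pt))
    (h₄ : ¬ Collinear ℝ ({B, C, D} : Set Pt))
    (hE₁ : E ∈ line A B) (hE₂ : E ∈ line C D)
    (hF₁ : F ∈ line B C) (hF₂ : F ∈ line A D)
    (hP₁ : P ∈ line B D) (hP₂ : P ∈ line E F)
    (hR₁ : R ∈ line A C) (hR₂ : R ∈ line E F)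
    (hO₁ : O ∈ line A C) (hO₂ : O ∈ line B D)
    (hPOR : AffineIndependent ℝ ![P, O, R])
    (hM : M = midpoint ℝ C E) (hN : N = midpoint ℝ B E) (hQ : Q = midpoint ℝ B C)
    (hU : U = midpoint ℝ C F) (hV : V = midpoint ℝ D F) (hT : T = midpoint ℝ D C)
    (hMNQ : AffineIndependent ℝ ![M, N, Q])
    (hUVT : AffineIndependent ℝ ![U, V, T])
    (hS₁ : S₁ ∈ line Q O ∧ S₁ ∈ line M R ∧ S₁ ∈ line N P)
    (hS₂ : S₂ ∈ line T O ∧ S₂ ∈ line U R ∧ S₂ ∈ line V P)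
    (hS₃ : S₃ ∈ line M U ∧ S₃ ∈ line Q T ∧ S₃ ∈ line N V) :
    Collinear ℝ ({S₁, S₂, S₃} : Set Pt) := by
  obtain ⟨x, y, xB, yB, xC, yC, xD, yD, hcol⟩ := exists_affine_coordinates h₄
  subst hM hN hQ hU hV hT
  have ha : x A ≠ 0 := fun h ↦ h₃ (hcol _ _ _ (by rw [xC, yC, xD, yD, h]; ring))
  have hb : y A ≠ 0 := fun h ↦ h₁ (hcol _ _ _ (by rw [xB, yB, xC, yC, h]; ring))
  have hab : 1 - x A - y A ≠ 0 := fun h ↦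
    h₂ (hcol _ _ _ (by rw [xB, yB, xD, yD]; linear_combination h))
  have e₁ := cross_eq_of_mem_line hE₁ x y
  have e₂ := cross_eq_of_mem_line hE₂ x y
  have f₁ := cross_eq_of_mem_line hF₁ x y
  have f₂ := cross_eq_of_mem_line hF₂ x y
  have r₁ := cross_eq_of_mem_line hR₁ x y
  have r₂ := cross_eq_of_mem_line hR₂ x y
  have o₁ := cross_eq_of_mem_line hO₁ x y
  have o₂ := cross_eq_of_mem_line hO₂ x y
  have s₁ := cross_eq_of_mem_line hS₁.1 x y
  have s₁' := cross_eq_of_mem_line hS₁.2.1 x y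
  have s₂ := cross_eq_of_mem_line hS₂.1 x y
  have s₂' := cross_eq_of_mem_line hS₂.2.1 x y
  have s₃ := cross_eq_of_mem_line hS₃.1 x y
  have s₃' := cross_eq_of_mem_line hS₃.2.1 x y
  simp only [map_midpoint_real, xB, yB, xC, yC, xD, yD]
    at e₁ e₂ f₁ f₂ r₁ r₂ o₁ o₂ s₁ s₁' s₂ s₂' s₃ s₃'
  have xE : x E = 0 := by linear_combination e₂
  have yF : y F = 0 := by linear_combination f₁
  rw [xE] at e₁ r₂ s₁' s₃
  rw [yF] at f₂ r₂ s₂' s₃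
  have he : y E * (1 - x A) = y A := by linear_combination -e₁
  have hf : x F * (1 - y A) = x A := by linear_combination f₂
  have hO : y A * x O = x A * y O := by linear_combination -o₁
  have hO' : x O + y O = 1 := by linear_combination o₂
  have hR : y A * x R = x A * y R := by linear_combination -r₁
  have hR' : y E * x R + x F * y R = y E * x F := by linear_combination -r₂
  obtain ⟨n₁, X₁, Y₁⟩ := homology_center_coordinates ha hb he hf hO hO' hR hR'
    (x := x S₁) (y := y S₁) (by linear_combination s₁) (by linear_combination s₁')
  obtain ⟨n₂, Y₂, X₂⟩ := homology_center_coordinates hb ha hf he hO.symm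
    (by linear_combination hO') hR.symm (by linear_combination hR')
    (x := y S₂) (y := x S₂) (by linear_combination -s₂) (by linear_combination -s₂')
  have l₃ : y A * (1 - y A) * x S₃ + x A * (1 - x A) * y S₃ = x A * y A / 2 := by
    linear_combination -2 * (1 - x A) * (1 - y A) * s₃ - (1 - y A) * x S₃ * he
      - (1 - x A) * y S₃ * hf + ((1 - y A) * x F * he + y A * hf) / 2
  have l₃' : x S₃ + y S₃ = 1 / 2 := by linear_combination 2 * s₃'
  have X₃ : (x A - y A) * x S₃ = x A / 2 := by
    refine mul_left_cancel₀ hab ?_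
    linear_combination x A * (1 - x A) * l₃' - l₃
  have Y₃ : (x A - y A) * y S₃ = - y A / 2 := by
    refine mul_left_cancel₀ hab ?_
    linear_combination l₃ - y A * (1 - y A) * l₃'
  have n₃ : x A - y A ≠ 0 := by
    intro h
    rw [h, zero_mul] at X₃
    exact ha (by linarith)
  generalize x A = a, y A = b at *
  apply hcol
  rw [eq_div_of_mul_eq n₁ ((mul_comm _ _).trans X₁), eq_div_of_mul_eq n₁ ((mul_comm _ _).trans Y₁),
    eq_div_of_mul_eq n₂ ((mul_comm _ _).trans X₂), eq_div_of_mul_eq n₂ ((mul_comm _ _).trans Y₂),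
    eq_div_of_mul_eq n₃ ((mul_comm _ _).trans X₃), eq_div_of_mul_eq n₃ ((mul_comm _ _).trans Y₃)]
  clear X₁ X₂ X₃ Y₁ Y₂ Y₃
  generalize hd₁ : (a - b) ^ 2 + 4 * a * (1 - a) = d₁ at *
  generalize hd₂ : (b - a) ^ 2 + 4 * b * (1 - b) = d₂ at *
  field_simp
  rw [← hd₁, ← hd₂]
  ring
end
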